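/- arXiv:1502.01216 — 2 statements merged into one kernel-verified Lean document; each statement's English description precedes it below -/
import Mathlib

section
/- Suppose a directed tree T ∈ ℛ(μ,d) contains disjoint directed paths (v, m₁, …, m_k, m) and (v′, m₁′, …, m_l′, m) from internal vertices v, v′ ∈ M to some vertex m ∈ M, with 0 ≤ k ≤ l, d(v) = d(v′), μ(v) < μ(v′), f_T(v) ≥ f_T(v′), and f_T(m_i) ≥ f_T(m_i′) for i = 1, …, k. If the directed tree T′ is obtained from T by swapping all incident arcs of the vertices v and v′, then T′ ∈ ℛ(μ,d) and f(T′) strictly weakly majorizes f(T), i.e., f(T′) ≻^w f(T). -/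
open scoped Classical
noncomputable section

/-- A directed tree on a finite vertex set `V`: each vertex has an outbound arc to its
`parent`, the `root` is a fixed point of `parent` (i.e. has no genuine outbound arc), and
every vertex reaches the root by iterating `parent`. -/
structure DirTree (V : Type) [Fintype V] [DecidableEq V] where
  root : V
  parent : V → V
  parent_root : parent root = root
  reaches : ∀ v, ∃ n, parent^[n] v = root

variable {V : Type} [Fintype V] [DecidableEq V]

namespace DirTree

/-- `u` belongs to the subordinate group of `v`: there is a directed path from `u` to `v`. -/
def Desc (T : DirTree V) (u v : V) : Prop := ∃ n, T.parent^[n] u = v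

/-- The set of vertices with an arc to `v`. -/
def children (T : DirTree V) (v : V) : Finset V :=
  Finset.univ.filter fun u => T.parent u = v ∧ u ≠ v

/-- Weight `f_T(v)` of the subordinate group of `v`. -/
def f (T : DirTree V) (μ : V → ℝ) (v : V) : ℝ :=
  ∑ u ∈ Finset.univ.filter (fun u => T.Desc u v), μ u

/-- Degree of `v` in the underlying undirected tree. -/
def deg (T : DirTree V) (v : V) : ℕ :=
  (T.children v).card + (if v = T.root then 0 else 1)

/-- The underlying undirected tree. -/
def toGraph (T : DirTree V) : SimpleGraph V :=
  SimpleGraph.fromRel fun u v => T.parent u = v ∧ u ≠ v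

/-- The vector (as a multiset, i.e. up to ascending rearrangement) of subordinate
groups' weights of internal non-root vertices. -/
def fvec (T : DirTree V) (μ : V → ℝ) : Multiset ℝ :=
  (Finset.univ.filter fun m => 1 < T.deg m ∧ m ≠ T.root).val.map (T.f μ)

end DirTree

/-- Degree of a vertex in a simple graph. -/
def gdeg (G : SimpleGraph V) (v : V) : ℕ :=
  (Finset.univ.filter fun u => G.Adj v u).card

/-- `⟨μ, d⟩` is a generating tuple: nonnegative weights, degrees at least 1 summing to
`2(|V|-1)`, at least two pendent and at least one internal vertex. -/
structure IsGenTuple (μ : V → ℝ) (d : V → ℕ) : Prop where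
  nonneg : ∀ v, 0 ≤ μ v
  deg_pos : ∀ v, 1 ≤ d v
  sum_deg : ∑ v, d v = 2 * (Fintype.card V - 1)
  two_le_pendent : 2 ≤ (Finset.univ.filter fun v => d v = 1).card
  one_le_internal : 1 ≤ (Finset.univ.filter fun v => 1 < d v).card

/-- Weights are degree-monotone in `⟨μ, d⟩`. -/
def DegMonotone (μ : V → ℝ) (d : V → ℕ) : Prop :=
  (∀ m m', 1 < d m → 1 < d m' → d m < d m' → μ m ≤ μ m') ∧
  ∀ v, d v = 1 → 0 < μ v

/-- `T ∈ ℛ(μ,d)`: directed tree with internal root whose (undirected) degrees match `d`. -/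
def memR (T : DirTree V) (d : V → ℕ) : Prop :=
  1 < d T.root ∧ ∀ v, T.deg v = d v

/-- `G ∈ 𝒯(μ,d)`: `G` is a tree whose degrees match `d`. -/
def memT (G : SimpleGraph V) (d : V → ℕ) : Prop :=
  G.IsTree ∧ ∀ v, gdeg G v = d v

/-- Vertex-weighted Wiener index. -/
def VWWI (μ : V → ℝ) (G : SimpleGraph V) : ℝ :=
  (1 / 2) * ∑ u, ∑ v, μ u * μ v * (G.dist u v : ℝ)

/-- `S = (m, L)` is a minimal star for the state `(U, μ, d)`: the center `m` is an
internal vertex of `U` of least degree among internal vertices of least weight, and the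
`d m - 1` leaves `L` are pendent vertices of `U` of least weights. -/
def IsMinimalStar (U : Finset V) (μ : V → ℝ) (d : V → ℕ) (m : V) (L : Finset V) : Prop :=
  m ∈ U ∧ 1 < d m ∧ L ⊆ U ∧ m ∉ L ∧ L.card = d m - 1 ∧
  (∀ v ∈ L, d v = 1) ∧
  (∀ m' ∈ U, 1 < d m' → μ m ≤ μ m') ∧
  (∀ m' ∈ U, 1 < d m' → μ m' = μ m → d m ≤ d m') ∧
  ∀ u ∈ L, ∀ w ∈ U, d w = 1 → w ∉ L → μ u ≤ μ w

/-- Centers used before step `i` (0-indexed). -/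
def usedCenters {q : ℕ} (c : Fin q → V) (i : ℕ) : Finset V :=
  (Finset.univ.filter fun j : Fin q => (j : ℕ) < i).image c

/-- Vertex set `V_{i+1}` of the state of the Huffman algorithm before (0-indexed) step `i`,
for the candidate Huffman tree `T` with star centers `c`. -/
def stateV (T : DirTree V) {q : ℕ} (c : Fin q → V) (i : ℕ) : Finset V :=
  Finset.univ \ (Finset.univ.filter fun j : Fin q => (j : ℕ) < i).biUnion fun j => T.children (c j)

/-- Weight function `μ^{i+1}` of the state before (0-indexed) step `i`. -/
def stateMu (T : DirTree V) (μ : V → ℝ) {q : ℕ} (c : Fin q → V) (i : ℕ) : V → ℝ :=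
  fun v => if v ∈ usedCenters c i then T.f μ v else μ v

/-- Degree function `d^{i+1}` of the state before (0-indexed) step `i`. -/
def stateD (d : V → ℕ) {q : ℕ} (c : Fin q → V) (i : ℕ) : V → ℕ :=
  fun v => if v ∈ usedCenters c i then 1 else d v

/-- `T` is a directed Huffman tree for `⟨μ, d⟩` whose star sequence has centers
`c 0, …, c (q-1)` (so `S_i` has leaf set `children (c i)`): the centers enumerate the
internal vertices, the root is the last center, and at each of the first `q - 1` steps
the corresponding star is a minimal star of the current state. -/
def IsHuffmanSeq (μ : V → ℝ) (d : V → ℕ) (T : DirTree V) {q : ℕ} (c : Fin q → V) : Prop :=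
  (∀ v, T.deg v = d v) ∧
  Function.Injective c ∧
  (∀ v, 1 < d v ↔ ∃ j, c j = v) ∧
  (∀ hq : 0 < q, T.root = c ⟨q - 1, Nat.sub_lt hq Nat.one_pos⟩) ∧
  ∀ i : Fin q, (i : ℕ) < q - 1 →
    IsMinimalStar (stateV T c (i : ℕ)) (stateMu T μ c (i : ℕ)) (stateD d c (i : ℕ))
      (c i) (T.children (c i))

/-- `T ∈ ℛℋ(μ,d)`: `T` is a directed Huffman tree for `⟨μ, d⟩`. -/
def IsHuffmanDir (μ : V → ℝ) (d : V → ℕ) (T : DirTree V) : Prop :=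
  ∃ (q : ℕ) (c : Fin q → V), IsHuffmanSeq μ d T c

/-- Sum of the `k` smallest components of a multiset of reals. -/
def ascSum (s : Multiset ℝ) (k : ℕ) : ℝ := ((s.sort (· ≤ ·)).take k).sum

/-- `x` weakly majorizes `y` (`y ⪯^w x`). -/
def WMaj (x y : Multiset ℝ) : Prop :=
  Multiset.card x = Multiset.card y ∧ ∀ k, ascSum x k ≤ ascSum y k

/-- `x` strictly weakly majorizes `y` (`y ≺^w x`). -/
def SWMaj (x y : Multiset ℝ) : Prop := WMaj x y ∧ x ≠ y

theorem ascSum_ge_sub_sum_posPart (s : Multiset ℝ) (c : ℝ) {k : ℕ} (hk : k ≤ s.card) :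
    k * c - (s.map fun x => max (c - x) 0).sum ≤ ascSum s k := by
  have first : ∀ l : List ℝ, l.length * c - (l.map fun x => max (c - x) 0).sum ≤ l.sum := by
    intro l
    induction l with
    | nil => simp
    | cons a l ih =>
      simp only [List.length_cons, List.map_cons, List.sum_cons]
      push_cast
      linarith [le_max_left (c - a) 0]
  have rest : ∀ l : List ℝ, 0 ≤ (l.map fun x => max (c - x) 0).sum := by
    intro l
    refine List.sum_nonneg fun x hx => ?_
    obtain ⟨y, -, rfl⟩ := List.mem_map.1 hx
    exact le_max_right _ _
  have hs : (s.map fun x => max (c - x) 0).sum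
      = ((s.sort (· ≤ ·)).map fun x => max (c - x) 0).sum := by
    conv_lhs => rw [← Multiset.sort_eq s (· ≤ ·)]
    rw [Multiset.map_coe, Multiset.sum_coe]
  have h₁ := first ((s.sort (· ≤ ·)).take k)
  have h₂ := rest ((s.sort (· ≤ ·)).drop k)
  rw [List.length_take, Multiset.length_sort, min_eq_left hk] at h₁
  rw [← List.take_append_drop k (s.sort (· ≤ ·)), List.map_append, List.sum_append] at hs
  rw [hs, ascSum]
  linarith

theorem exists_ascSum_le_sub_sum_posPart (s : Multiset ℝ) {k : ℕ} (hk : k ≤ s.card)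
    (hk₀ : 0 < k) :
    ∃ c, ascSum s k ≤ k * c - (s.map fun x => max (c - x) 0).sum := by
  have first : ∀ (c : ℝ) (l : List ℝ), (∀ x ∈ l, x ≤ c) →
      l.sum = l.length * c - (l.map fun x => max (c - x) 0).sum := by
    intro c l hl
    induction l with
    | nil => simp
    | cons a l ih =>
      simp only [List.length_cons, List.map_cons, List.sum_cons]
      rw [ih fun x hx => hl x (List.mem_cons_of_mem _ hx),
        max_eq_left (sub_nonneg.2 (hl a List.mem_cons_self))]
      push_cast
      ring
  have rest : ∀ (c : ℝ) (l : List ℝ), (∀ x ∈ l, c ≤ x) →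
      (l.map fun x => max (c - x) 0).sum = 0 := by
    intro c l hl
    refine List.sum_eq_zero fun x hx => ?_
    obtain ⟨y, hy, rfl⟩ := List.mem_map.1 hx
    exact max_eq_right (sub_nonpos.2 (hl y hy))
  have hs : ∀ c, (s.map fun x => max (c - x) 0).sum
      = ((s.sort (· ≤ ·)).map fun x => max (c - x) 0).sum := by
    intro c
    conv_lhs => rw [← Multiset.sort_eq s (· ≤ ·)]
    rw [Multiset.map_coe, Multiset.sum_coe]
  have hlen : (s.sort (· ≤ ·)).length = s.card := Multiset.length_sort _
  have hsort : ∀ i j (hi : i < (s.sort (· ≤ ·)).length) (hj : j < (s.sort (· ≤ ·)).length),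
      i ≤ j → (s.sort (· ≤ ·))[i] ≤ (s.sort (· ≤ ·))[j] := by
    intro i j hi hj hij
    rcases hij.eq_or_lt with rfl | hij
    · exact le_rfl
    · exact List.pairwise_iff_getElem.1 (Multiset.pairwise_sort s (· ≤ ·)) i j hi hj hij
  have hlt : k - 1 < (s.sort (· ≤ ·)).length := by omega
  refine ⟨(s.sort (· ≤ ·))[k - 1], ?_⟩
  set c := (s.sort (· ≤ ·))[k - 1] with hc
  have h₁ := first c ((s.sort (· ≤ ·)).take k) (by
    intro x hx
    obtain ⟨i, hi, rfl⟩ := List.mem_iff_getElem.1 hx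
    rw [List.getElem_take]
    rw [List.length_take] at hi
    exact hsort _ _ _ _ (by omega))
  have h₂ := rest c ((s.sort (· ≤ ·)).drop k) (by
    intro x hx
    obtain ⟨i, hi, rfl⟩ := List.mem_iff_getElem.1 hx
    rw [List.getElem_drop]
    exact hsort _ _ _ _ (by omega))
  have h₃ := hs c
  rw [← List.take_append_drop k (s.sort (· ≤ ·)), List.map_append, List.sum_append, h₂] at h₃
  rw [List.length_take, hlen, min_eq_left hk] at h₁
  rw [h₃, ascSum, h₁, add_zero]

theorem WMaj.of_sum_posPart_le {s t : Multiset ℝ} (hcard : s.card = t.card)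
    (h : ∀ c : ℝ, (t.map fun x => max (c - x) 0).sum ≤ (s.map fun x => max (c - x) 0).sum) :
    WMaj s t := by
  have main : ∀ k ≤ s.card, ascSum s k ≤ ascSum t k := by
    intro k hk
    rcases Nat.eq_zero_or_pos k with rfl | hk₀
    · simp [ascSum]
    · obtain ⟨c, hc⟩ := exists_ascSum_le_sub_sum_posPart s hk hk₀
      linarith [h c, ascSum_ge_sub_sum_posPart t c (hcard ▸ hk)]
  refine ⟨hcard, fun k => ?_⟩
  rcases le_total k s.card with hk | hk
  · exact main k hk
  · have := main s.card le_rfl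
    rw [ascSum, ascSum, List.take_of_length_le (by simp),
      List.take_of_length_le (by simp [hcard])] at this
    rwa [ascSum, ascSum, List.take_of_length_le (by simpa using hk),
      List.take_of_length_le (by simpa [hcard] using hk)]

/-- Spreading the values `F a` up and `F b` down by `δ` along two lists does not decrease the sum
of a function that is suitably convex and decreasing. -/
theorem sum_spread_nonneg {α : Type*} (F : α → ℝ) (φ : ℝ → ℝ) (δ : ℝ)
    (hpair : ∀ a b, b ≤ a → 0 ≤ φ (a + δ) - φ a + (φ (b - δ) - φ b))
    (hdecr : ∀ b, 0 ≤ φ (b - δ) - φ b) :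
    ∀ L L' : List α, L.length ≤ L'.length →
      (∀ i (hi : i < L.length) (hi' : i < L'.length), F L'[i] ≤ F L[i]) →
      0 ≤ (L.map fun x => φ (F x + δ) - φ (F x)).sum
        + (L'.map fun x => φ (F x - δ) - φ (F x)).sum
  | [], L', _, _ => by
    simp only [List.map_nil, List.sum_nil, zero_add]
    refine List.sum_nonneg fun x hx => ?_
    obtain ⟨y, -, rfl⟩ := List.mem_map.1 hx
    exact hdecr _
  | a :: L, [], h, _ => by simp at h
  | a :: L, b :: L', h, hle => by
    have ih := sum_spread_nonneg F φ δ hpair hdecr L L' (by simpa using h)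
      fun i hi hi' => hle (i + 1) (Nat.succ_lt_succ hi) (Nat.succ_lt_succ hi')
    have h₀ := hpair (F a) (F b) (hle 0 (Nat.succ_pos _) (Nat.succ_pos _))
    simp only [List.map_cons, List.sum_cons]
    linarith

theorem posPart_spread (c δ a b : ℝ) (hδ : 0 ≤ δ) (hab : b ≤ a) :
    0 ≤ max (c - (a + δ)) 0 - max (c - a) 0 + (max (c - (b - δ)) 0 - max (c - b) 0) := by
  rcases max_cases (c - (a + δ)) 0 with h₁ | h₁ <;> rcases max_cases (c - a) 0 with h₂ | h₂ <;>
    rcases max_cases (c - (b - δ)) 0 with h₃ | h₃ <;>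
    rcases max_cases (c - b) 0 with h₄ | h₄ <;> linarith

theorem exp_neg_spread (δ a b : ℝ) (hδ : 0 < δ) (hab : b ≤ a) :
    0 < Real.exp (-(a + δ)) - Real.exp (-a) + (Real.exp (-(b - δ)) - Real.exp (-b)) := by
  have h₁ : Real.exp (-(a + δ)) = Real.exp (-a) * Real.exp (-δ) := by
    rw [← Real.exp_add]; ring_nf
  have h₂ : Real.exp (-(b - δ)) = Real.exp (-b) * Real.exp δ := by
    rw [← Real.exp_add]; ring_nf
  have h₃ : Real.exp (-a) ≤ Real.exp (-b) := Real.exp_le_exp.2 (by linarith)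
  have h₄ := Real.add_one_lt_exp hδ.ne'
  have h₅ := Real.add_one_lt_exp (neg_ne_zero.2 hδ.ne')
  have h₆ := Real.exp_pos (-a)
  rw [h₁, h₂]
  nlinarith [mul_nonneg (sub_nonneg.2 h₃) (show (0 : ℝ) ≤ Real.exp δ - 1 by linarith),
    mul_pos h₆ (show (0 : ℝ) < Real.exp δ + Real.exp (-δ) - 2 by linarith)]

namespace DirTree

theorem desc_refl (T : DirTree V) (u : V) : T.Desc u u := ⟨0, rfl⟩

theorem desc_iff (T : DirTree V) (u w : V) : T.Desc u w ↔ w = u ∨ T.Desc (T.parent u) w := by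
  constructor
  · rintro ⟨_ | n, hn⟩
    · exact Or.inl hn.symm
    · exact Or.inr ⟨n, hn⟩
  · rintro (rfl | ⟨n, hn⟩)
    · exact T.desc_refl _
    · exact ⟨n + 1, hn⟩

theorem eq_root_of_iterate_eq (T : DirTree V) {u : V} {n : ℕ} (hn : 0 < n)
    (h : T.parent^[n] u = u) : u = T.root := by
  obtain ⟨k, hk⟩ := T.reaches u
  have h₁ : T.parent^[n * k] u = u := by
    rw [Function.iterate_mul]
    exact Function.iterate_fixed h k
  obtain ⟨j, hj⟩ := Nat.exists_eq_add_of_le (Nat.le_mul_of_pos_left k hn)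
  rw [hj, add_comm, Function.iterate_add_apply, hk, Function.iterate_fixed T.parent_root] at h₁
  exact h₁.symm

theorem eq_root_of_desc (T : DirTree V) {w : V} (h : T.Desc T.root w) : w = T.root := by
  obtain ⟨n, hn⟩ := h
  rw [← hn, Function.iterate_fixed T.parent_root]

theorem desc_antisymm (T : DirTree V) {u w : V} (h₁ : T.Desc u w) (h₂ : T.Desc w u) : u = w := by
  obtain ⟨a, ha⟩ := h₁
  obtain ⟨b, hb⟩ := h₂
  rcases Nat.eq_zero_or_pos (b + a) with h | h
  · obtain rfl : a = 0 := by omega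
    exact ha
  · have hu : u = T.root :=
      T.eq_root_of_iterate_eq h (by rw [Function.iterate_add_apply, ha, hb])
    subst hu
    exact (T.eq_root_of_desc ⟨a, ha⟩).symm

section Path

variable (T : DirTree V) {m : V}

theorem desc_iff_of_path : ∀ {v : V} {l : List V},
    ((v :: l) ++ [m]).IsChain (fun a b => T.parent a = b) →
      ∀ x, T.Desc v x ↔ x ∈ v :: l ∨ T.Desc m x
  | v, [], h, x => by
    have hp : T.parent v = m := by simpa using h
    rw [T.desc_iff, hp]
    simp
  | v, w :: l, h, x => by
    simp only [List.cons_append, List.isChain_cons_cons] at h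
    rw [T.desc_iff, h.1, desc_iff_of_path (v := w) (l := l) (by simpa using h.2),
      List.mem_cons (a := x) (b := v), or_assoc]

theorem desc_end_of_path : ∀ {v : V} {l : List V},
    ((v :: l) ++ [m]).IsChain (fun a b => T.parent a = b) → ∀ x ∈ v :: l, T.Desc x m
  | v, [], h, x, hx => by
    obtain rfl : x = v := by simpa using hx
    exact (T.desc_iff_of_path h m).2 (Or.inr (T.desc_refl m))
  | v, w :: l, h, x, hx => by
    rcases List.mem_cons.1 hx with rfl | hx
    · exact (T.desc_iff_of_path h m).2 (Or.inr (T.desc_refl m))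
    · simp only [List.cons_append, List.isChain_cons_cons] at h
      exact desc_end_of_path (v := w) (l := l) (by simpa using h.2) x hx

theorem exists_parent_eq_of_path : ∀ {v : V} {l : List V},
    ((v :: l) ++ [m]).IsChain (fun a b => T.parent a = b) → ∀ x ∈ l, ∃ y, T.parent y = x
  | _, [], _, _, hx => by simp at hx
  | v, w :: l, h, x, hx => by
    simp only [List.cons_append, List.isChain_cons_cons] at h
    rcases List.mem_cons.1 hx with rfl | hx
    · exact ⟨v, h.1⟩
    · exact exists_parent_eq_of_path (v := w) (l := l) (by simpa using h.2) x hx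

theorem not_desc_of_path {v : V} {l : List V}
    (h : ((v :: l) ++ [m]).IsChain (fun a b => T.parent a = b)) (hnd : ((v :: l) ++ [m]).Nodup)
    {x : V} (hx : x ∈ v :: l) : ¬ T.Desc m x := fun hmx => by
  have hxm := T.desc_antisymm (T.desc_end_of_path h x hx) hmx
  exact (List.nodup_append.1 hnd).2.2 x hx m (by simp) hxm

theorem ne_root_of_path {v : V} {l : List V}
    (h : ((v :: l) ++ [m]).IsChain (fun a b => T.parent a = b)) (hnd : ((v :: l) ++ [m]).Nodup)
    {x : V} (hx : x ∈ v :: l) : x ≠ T.root := by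
  rintro rfl
  refine T.not_desc_of_path h hnd hx ?_
  have := T.eq_root_of_desc (T.desc_end_of_path h _ hx)
  rw [this]
  exact T.desc_refl _

theorem one_lt_deg_of_path {v : V} {l : List V}
    (h : ((v :: l) ++ [m]).IsChain (fun a b => T.parent a = b)) (hnd : ((v :: l) ++ [m]).Nodup)
    {x : V} (hx : x ∈ l) : 1 < T.deg x := by
  have hr := T.ne_root_of_path h hnd (List.mem_cons_of_mem v hx)
  obtain ⟨y, hy⟩ := T.exists_parent_eq_of_path h x hx
  have hyx : y ≠ x := by
    rintro rfl
    exact hr (T.eq_root_of_iterate_eq one_pos hy)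
  have : 0 < (T.children x).card := Finset.card_pos.2 ⟨y, by simp [children, hy, hyx]⟩
  rw [deg, if_neg hr]
  omega

end Path

section Relabel

variable {T T' : DirTree V} {σ : Equiv.Perm V}

theorem desc_relabel (hpar : ∀ u, T'.parent (σ u) = σ (T.parent u))
    (u w : V) : T'.Desc (σ u) (σ w) ↔ T.Desc u w := by
  have : ∀ n, T'.parent^[n] (σ u) = σ (T.parent^[n] u) := fun n =>
    ((Function.Semiconj.iterate_right (f := σ) (fun x => (hpar x).symm) n) u).symm
  simp [Desc, this]

theorem f_relabel (hpar : ∀ u, T'.parent (σ u) = σ (T.parent u))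
    (μ : V → ℝ) (w : V) :
    T'.f μ (σ w) = ∑ u ∈ Finset.univ.filter (fun u => T.Desc u w), μ (σ u) := by
  rw [f]
  refine (Finset.sum_equiv σ (fun u => ?_) fun _ _ => rfl).symm
  simp [desc_relabel hpar]

theorem deg_relabel (hpar : ∀ u, T'.parent (σ u) = σ (T.parent u))
    (hroot : T'.root = σ T.root) (w : V) : T'.deg (σ w) = T.deg w := by
  have : (T'.children (σ w)).card = (T.children w).card := by
    refine (Finset.card_equiv σ fun u => ?_).symm
    simp [children, hpar]
  simp [deg, this, hroot]

theorem fvec_relabel (hpar : ∀ u, T'.parent (σ u) = σ (T.parent u))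
    (hroot : T'.root = σ T.root) (μ : V → ℝ) :
    T'.fvec μ
      = (Finset.univ.filter fun w => 1 < T.deg w ∧ w ≠ T.root).val.map fun w => T'.f μ (σ w) := by
  have : (Finset.univ.filter fun w => 1 < T'.deg w ∧ w ≠ T'.root)
      = (Finset.univ.filter fun w => 1 < T.deg w ∧ w ≠ T.root).map σ.toEmbedding := by
    ext w
    obtain ⟨u, rfl⟩ := σ.surjective w
    simp [deg_relabel hpar hroot, hroot]
  rw [fvec, this, Finset.map_val, Multiset.map_map]
  rfl

end Relabel

end DirTree

theorem sum_swap_weights {α : Type*} [DecidableEq α] (μ : α → ℝ) {v v' : α} (hne : v ≠ v')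
    (s : Finset α) :
    ∑ u ∈ s, μ (Equiv.swap v v' u)
      = ∑ u ∈ s, μ u + (if v ∈ s then μ v' - μ v else 0) - (if v' ∈ s then μ v' - μ v else 0) := by
  have : ∀ u, μ (Equiv.swap v v' u)
      = μ u + (if v = u then μ v' - μ v else 0) - (if v' = u then μ v' - μ v else 0) := by
    intro u
    by_cases h : v = u
    · subst h
      simp [hne.symm]
    · by_cases h' : v' = u
      · subst h'
        simp [hne]
      · simp [h, h', Equiv.swap_apply_of_ne_of_ne (Ne.symm h) (Ne.symm h')]
  simp only [this, Finset.sum_sub_distrib, Finset.sum_add_distrib, Finset.sum_ite_eq]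

/-- Changing a function on two disjoint duplicate-free lists inside a finset changes its sum by the
corresponding sums over the lists. -/
theorem sum_eq_add_sum_lists {α : Type*} [DecidableEq α] (s : Finset α) (F G : α → ℝ)
    {L L' : List α}
    (hL : L.Nodup) (hL' : L'.Nodup) (hdisj : L.Disjoint L')
    (hs : ∀ x ∈ L, x ∈ s) (hs' : ∀ x ∈ L', x ∈ s)
    (hoff : ∀ x ∈ s, x ∉ L → x ∉ L' → G x = F x) :
    ∑ x ∈ s, G x = ∑ x ∈ s, F x + ((L.map fun x => G x - F x).sum
      + (L'.map fun x => G x - F x).sum) := by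
  have hsub : L.toFinset ∪ L'.toFinset ⊆ s := by
    intro x hx
    rcases Finset.mem_union.1 hx with hx | hx
    · exact hs x (List.mem_toFinset.1 hx)
    · exact hs' x (List.mem_toFinset.1 hx)
  rw [← List.sum_toFinset _ hL, ← List.sum_toFinset _ hL', ← Finset.sum_union
    (List.disjoint_toFinset_iff_disjoint.2 hdisj), Finset.sum_subset hsub, Finset.sum_sub_distrib]
  · ring
  · intro x hx hxn
    simp only [Finset.mem_union, List.mem_toFinset, not_or] at hxn
    rw [hoff x hx hxn.1 hxn.2, sub_self]

/-- if disjoint paths lead from internal vertices `v`, `v'` to `m`, with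
`k ≤ l`, `d(v) = d(v')`, `μ(v) < μ(v')`, `f_T(v) ≥ f_T(v')`, and `f_T(m_i) ≥ f_T(m_i')`
for `i = 1, …, k`, then the tree obtained by swapping all incident arcs of `v` and `v'`
(i.e. relabelling by the transposition of `v` and `v'`) lies in `ℛ(μ,d)` and its vector
of subordinate groups' weights strictly weakly majorizes that of `T`. -/
theorem exchange_lemma_five {V : Type} [Fintype V] [DecidableEq V]
    (μ : V → ℝ) (d : V → ℕ) (hgen : IsGenTuple μ d)
    (T : DirTree V) (hT : memR T d)
    (v v' m : V) (ms ms' : List V)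
    (hm : 1 < d m) (hv : 1 < d v) (hv' : 1 < d v')
    (hpath : ((v :: ms) ++ [m]).Chain' fun a b => T.parent a = b)
    (hnodup : ((v :: ms) ++ [m]).Nodup)
    (hpath' : ((v' :: ms') ++ [m]).Chain' fun a b => T.parent a = b)
    (hnodup' : ((v' :: ms') ++ [m]).Nodup)
    (hdisj : (v :: ms).Disjoint (v' :: ms'))
    (hkl : ms.length ≤ ms'.length)
    (hdeg : d v = d v') (hμ : μ v < μ v')
    (hf : T.f μ v' ≤ T.f μ v)
    (hmaj : ∀ i : ℕ, ∀ hi : i < ms.length,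
      T.f μ (ms'.get ⟨i, lt_of_lt_of_le hi hkl⟩) ≤ T.f μ (ms.get ⟨i, hi⟩))
    (T' : DirTree V) (hroot : T'.root = Equiv.swap v v' T.root)
    (hpar : ∀ u, T'.parent u = Equiv.swap v v' (T.parent (Equiv.swap v v' u))) :
    memR T' d ∧ SWMaj (T'.fvec μ) (T.fvec μ) := by
  set σ := Equiv.swap v v' with hσ
  have hne : v ≠ v' := by
    rintro rfl
    exact lt_irrefl _ hμ
  have hpar' : ∀ u, T'.parent (σ u) = σ (T.parent u) := fun u => by
    rw [hpar, hσ, Equiv.swap_apply_self]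
  have hdσ : ∀ u, d (σ u) = d u := by
    intro u
    rw [hσ, Equiv.swap_apply_def]
    split_ifs with h₁ h₂
    · rw [h₁, hdeg]
    · rw [h₂, hdeg]
    · rfl
  refine ⟨⟨by rw [hroot, hdσ]; exact hT.1, fun u => ?_⟩, ?_⟩
  · obtain ⟨w, rfl⟩ := σ.surjective u
    rw [DirTree.deg_relabel hpar' hroot, hdσ, hT.2]
  set δ := μ v' - μ v with hδ
  have hδ₀ : 0 < δ := sub_pos.2 hμ
  have hfσ : ∀ w, T'.f μ (σ w)
      = T.f μ w + (if T.Desc v w then δ else 0) - (if T.Desc v' w then δ else 0) := by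
    intro w
    rw [DirTree.f_relabel hpar', sum_swap_weights μ hne]
    simp [DirTree.f, hδ]
  have hup : ∀ w ∈ v :: ms, T'.f μ (σ w) = T.f μ w + δ := by
    intro w hw
    have h₂ : ¬ T.Desc v' w := by
      rw [T.desc_iff_of_path hpath', not_or]
      exact ⟨fun h => hdisj hw h, T.not_desc_of_path hpath hnodup hw⟩
    rw [hfσ, if_pos ((T.desc_iff_of_path hpath w).2 (Or.inl hw)), if_neg h₂, sub_zero]
  have hdown : ∀ w ∈ v' :: ms', T'.f μ (σ w) = T.f μ w - δ := by
    intro w hw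
    have h₂ : ¬ T.Desc v w := by
      rw [T.desc_iff_of_path hpath, not_or]
      exact ⟨fun h => hdisj h hw, T.not_desc_of_path hpath' hnodup' hw⟩
    rw [hfσ, if_pos ((T.desc_iff_of_path hpath' w).2 (Or.inl hw)), if_neg h₂, add_zero]
  have hoff : ∀ w, w ∉ v :: ms → w ∉ v' :: ms' → T'.f μ (σ w) = T.f μ w := by
    intro w h₁ h₂
    have : T.Desc v w ↔ T.Desc v' w := by
      rw [T.desc_iff_of_path hpath, T.desc_iff_of_path hpath']
      tauto
    rw [hfσ]
    simp [this]
  set I := Finset.univ.filter fun w => 1 < T.deg w ∧ w ≠ T.root with hI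
  have hLI : ∀ x ∈ v :: ms, x ∈ I := by
    intro x hx
    refine Finset.mem_filter.2 ⟨Finset.mem_univ _, ?_, T.ne_root_of_path hpath hnodup hx⟩
    rcases List.mem_cons.1 hx with rfl | hx
    · rwa [hT.2]
    · exact T.one_lt_deg_of_path hpath hnodup hx
  have hLI' : ∀ x ∈ v' :: ms', x ∈ I := by
    intro x hx
    refine Finset.mem_filter.2 ⟨Finset.mem_univ _, ?_, T.ne_root_of_path hpath' hnodup' hx⟩
    rcases List.mem_cons.1 hx with rfl | hx
    · rwa [hT.2]
    · exact T.one_lt_deg_of_path hpath' hnodup' hx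
  have hsum : ∀ φ : ℝ → ℝ, ((T'.fvec μ).map φ).sum = ((T.fvec μ).map φ).sum
      + (((v :: ms).map fun x => φ (T.f μ x + δ) - φ (T.f μ x)).sum
        + ((v' :: ms').map fun x => φ (T.f μ x - δ) - φ (T.f μ x)).sum) := by
    intro φ
    rw [DirTree.fvec_relabel hpar' hroot, DirTree.fvec, Multiset.map_map, Multiset.map_map]
    refine (sum_eq_add_sum_lists I (fun x => φ (T.f μ x)) (fun x => φ (T'.f μ (σ x)))
      (List.nodup_append.1 hnodup).1 (List.nodup_append.1 hnodup').1 hdisj hLI hLI'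
      fun x _ h₁ h₂ => by rw [hoff x h₁ h₂]).trans ?_
    rw [List.map_congr_left fun x hx => by rw [hup x hx],
      List.map_congr_left (l := v' :: ms') fun x hx => by rw [hdown x hx]]
    rfl
  have hmaj' : ∀ i (hi : i < ms.length) (hi' : i < ms'.length),
      T.f μ ms'[i] ≤ T.f μ ms[i] := fun i hi _ => hmaj i hi
  refine ⟨WMaj.of_sum_posPart_le ?_ fun c => ?_, fun heq => ?_⟩
  · rw [DirTree.fvec_relabel hpar' hroot, DirTree.fvec, Multiset.card_map, Multiset.card_map]
  · have h₁ := sum_spread_nonneg (T.f μ) (fun x => max (c - x) 0) δ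
      (fun a b hab => posPart_spread c δ a b hδ₀.le hab)
      (fun b => sub_nonneg.2 (max_le_max_right 0 (by linarith))) ms ms' hkl hmaj'
    have h₂ := posPart_spread c δ _ _ hδ₀.le hf
    rw [hsum]
    simp only [List.map_cons, List.sum_cons] at h₁ ⊢
    linarith
  · have h₁ := sum_spread_nonneg (T.f μ) (fun x => Real.exp (-x)) δ
      (fun a b hab => (exp_neg_spread δ a b hδ₀ hab).le)
      (fun b => sub_nonneg.2 (Real.exp_le_exp.2 (by linarith))) ms ms' hkl hmaj'
    have h₂ := exp_neg_spread δ _ _ hδ₀ hf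
    have h₃ := hsum fun x => Real.exp (-x)
    rw [heq] at h₃
    simp only [List.map_cons, List.sum_cons] at h₁ h₃
    linarith
end
end

section
/- Suppose a directed tree T ∈ ℛ(μ,d) contains a directed path (v′, m₁, …, m_k, v) with k ≥ 0, where d(v) = d(v′) and μ(v′) > μ(v). If the directed tree T′ is obtained from T by swapping all incident arcs of the vertices v and v′, then T′ ∈ ℛ(μ,d) and f(T′) strictly weakly majorizes f(T), i.e., f(T′) ≻^w f(T). -/
open scoped Classical
noncomputable section

variable {V : Type} [Fintype V] [DecidableEq V]

/-- Prepending a lower bound of a list does not increase the sums of its initial segments. -/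
theorem sum_take_cons_le_sum_take (l : List ℝ) (a : ℝ) (hl : (a :: l).Pairwise (· ≤ ·)) (k : ℕ)
    (hk : k ≤ l.length) : ((a :: l).take k).sum ≤ (l.take k).sum := by
  induction l generalizing a k with
  | nil => simp_all
  | cons b l ih =>
    cases k with
    | zero => simp
    | succ k =>
      have hab : a ≤ b := List.rel_of_pairwise_cons hl (by simp)
      have := ih b hl.of_cons k (by simpa using hk)
      simp only [List.take_succ_cons, List.sum_cons] at this ⊢
      linarith

/-- An initial segment of an ascending list has the least sum among sublists of its length. -/
theorem sum_take_le_sum_of_sublist {l' l : List ℝ} (h : l'.Sublist l)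
    (hl : l.Pairwise (· ≤ ·)) : (l.take l'.length).sum ≤ l'.sum := by
  induction h with
  | slnil => simp
  | cons a h ih =>
    exact (sum_take_cons_le_sum_take _ a hl _ h.length_le).trans (ih hl.of_cons)
  | cons_cons a h ih =>
    simpa using ih hl.of_cons

theorem ascSum_card_le_sum {t s : Multiset ℝ} (h : t ≤ s) :
    ascSum s (Multiset.card t) ≤ t.sum := by
  rw [← Multiset.sort_eq s (· ≤ ·), ← Multiset.coe_toList t, Multiset.coe_le] at h
  obtain ⟨l, hlt, hls⟩ := h
  have := sum_take_le_sum_of_sublist hls (Multiset.pairwise_sort s (· ≤ ·))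
  rwa [hlt.length_eq, hlt.sum_eq, Multiset.length_toList, Multiset.sum_toList] at this

theorem ascSum_map_le_ascSum_map {ι : Type*} (s : Multiset ι) {g h : ι → ℝ}
    (hgh : ∀ i, g i ≤ h i) (k : ℕ) : ascSum (s.map g) k ≤ ascSum (s.map h) k := by
  wlog hk : k ≤ Multiset.card s generalizing k
  · have key := this (Multiset.card s) le_rfl
    unfold ascSum at key ⊢
    rw [List.take_of_length_le (by simp), List.take_of_length_le (by simp)] at key
    rwa [List.take_of_length_le (by simp; omega), List.take_of_length_le (by simp; omega)]
  have hle : (((s.map h).sort (· ≤ ·)).take k : Multiset ℝ) ≤ s.map h := by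
    conv_rhs => rw [← Multiset.sort_eq (s.map h) (· ≤ ·)]
    exact (List.take_sublist _ _).subperm
  obtain ⟨t, hts, ht⟩ : ∃ t ≤ s, t.map h = ((s.map h).sort (· ≤ ·)).take k := by
    conv at hle => rhs; rw [← Multiset.coe_toList s, Multiset.map_coe]
    rw [Multiset.coe_le] at hle
    obtain ⟨l, hl, hls⟩ := hle
    obtain ⟨l', hl', rfl⟩ := List.sublist_map_iff.1 hls
    refine ⟨l', ?_, ?_⟩
    · conv_rhs => rw [← Multiset.coe_toList s]
      exact hl'.subperm
    · exact Multiset.coe_eq_coe.2 hl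
  have htk : Multiset.card t = k := by
    have := congrArg Multiset.card ht
    simpa [hk] using this
  have h1 := ascSum_card_le_sum (Multiset.map_le_map hts (f := g))
  rw [Multiset.card_map, htk] at h1
  refine h1.trans ((Multiset.sum_map_le_sum_map g h fun i _ => hgh i).trans ?_)
  rw [ht, Multiset.sum_coe]
  rfl

/-- Pointwise smaller components give a weakly majorizing vector, strictly so if some component
is strictly smaller. -/
theorem swMaj_map_of_le {ι : Type*} (s : Finset ι) {g h : ι → ℝ} (hgh : ∀ i, g i ≤ h i)
    {i : ι} (hi : i ∈ s) (hlt : g i < h i) : SWMaj (s.val.map g) (s.val.map h) :=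
  ⟨⟨by simp, ascSum_map_le_ascSum_map _ hgh⟩, fun heq =>
    (Finset.sum_lt_sum (fun j _ => hgh j) ⟨i, hi, hlt⟩).ne (congrArg Multiset.sum heq)⟩

theorem apply_swap_le {ι : Type*} [DecidableEq ι] {μ : ι → ℝ} {u v w : ι}
    (hμ : μ v ≤ μ u) (hw : w ≠ v) :
    μ (Equiv.swap v u w) ≤ μ w := by
  by_cases hwu : w = u
  · simpa [hwu] using hμ
  · rw [Equiv.swap_apply_of_ne_of_ne hw hwu]

namespace DirTree

section Semiconj

variable {V : Type} [Fintype V] [DecidableEq V] {T T' : DirTree V} {σ : Equiv.Perm V}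

theorem iterate_parent_of_semiconj (hσ : ∀ u, T'.parent (σ u) = σ (T.parent u)) (n : ℕ) (u : V) :
    T'.parent^[n] (σ u) = σ (T.parent^[n] u) :=
  ((Function.Semiconj.iterate_right (f := σ) (fun u => (hσ u).symm) n) u).symm

theorem desc_of_semiconj (hσ : ∀ u, T'.parent (σ u) = σ (T.parent u)) (u w : V) :
    T'.Desc (σ u) (σ w) ↔ T.Desc u w := by
  simp [Desc, iterate_parent_of_semiconj hσ]

theorem f_of_semiconj (hσ : ∀ u, T'.parent (σ u) = σ (T.parent u)) (μ : V → ℝ) (w : V) :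
    T'.f μ (σ w) = T.f (μ ∘ σ) w := by
  unfold f
  refine (Finset.sum_equiv σ (fun u => ?_) fun u _ => rfl).symm
  simp [desc_of_semiconj hσ]

theorem deg_of_semiconj (hσ : ∀ u, T'.parent (σ u) = σ (T.parent u)) (hroot : T'.root = σ T.root)
    (w : V) : T'.deg (σ w) = T.deg w := by
  have hcard : (T.children w).card = (T'.children (σ w)).card :=
    Finset.card_equiv σ fun u => by simp [children, hσ]
  simp [deg, hroot, hcard]

theorem fvec_of_semiconj (hσ : ∀ u, T'.parent (σ u) = σ (T.parent u)) (hroot : T'.root = σ T.root)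
    (μ : V → ℝ) : T'.fvec μ = T.fvec (μ ∘ σ) := by
  have hset : (Finset.univ.filter fun m => 1 < T'.deg m ∧ m ≠ T'.root) =
      (Finset.univ.filter fun m => 1 < T.deg m ∧ m ≠ T.root).map σ.toEmbedding := by
    ext m
    obtain ⟨w, rfl⟩ := σ.surjective m
    simp [deg_of_semiconj hσ hroot, hroot]
  unfold fvec
  rw [hset, Finset.map_val, Multiset.map_map]
  exact Multiset.map_congr rfl fun w _ => f_of_semiconj hσ μ w

end Semiconj

variable {V : Type} [Fintype V] [DecidableEq V] {T : DirTree V} {u v w : V}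

theorem Desc.trans (huv : T.Desc u v) (hvw : T.Desc v w) : T.Desc u w := by
  obtain ⟨a, rfl⟩ := huv
  obtain ⟨b, rfl⟩ := hvw
  exact ⟨b + a, Function.iterate_add_apply _ _ _ _⟩

theorem iterate_parent_root (T : DirTree V) (n : ℕ) : T.parent^[n] T.root = T.root :=
  Function.iterate_fixed T.parent_root n

theorem Desc.eq_root (h : T.Desc T.root v) : v = T.root := by
  obtain ⟨n, rfl⟩ := h
  exact T.iterate_parent_root n

theorem Desc.antisymm (huv : T.Desc u v) (hvu : T.Desc v u) : u = v := by
  by_contra hne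
  obtain ⟨a, ha⟩ := huv
  obtain ⟨b, hb⟩ := hvu
  have hper : T.parent^[b + a] u = u := by rw [Function.iterate_add_apply, ha, hb]
  have hpos : 0 < b + a := by
    rcases Nat.eq_zero_or_pos a with rfl | h
    · exact absurd ha hne
    · omega
  obtain ⟨n, hn⟩ := T.reaches u
  have hfix : T.parent^[(b + a) * n] u = u := by
    rw [Function.iterate_mul]
    exact Function.iterate_fixed hper n
  have hu : u = T.root := by
    obtain ⟨c, hc⟩ := Nat.exists_eq_add_of_le' (Nat.le_mul_of_pos_left n hpos)
    rw [← hfix, hc, Function.iterate_add_apply, hn, iterate_parent_root]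
  have hv : v = T.root := Desc.eq_root ⟨a, hu ▸ ha⟩
  exact hne (hu.trans hv.symm)

theorem Desc.children_nonempty (h : T.Desc u v) (hne : u ≠ v) : (T.children v).Nonempty := by
  obtain ⟨n, hn⟩ := h
  induction n with
  | zero => exact absurd hn hne
  | succ n ih =>
    by_cases hv : T.parent^[n] u = v
    · exact ih hv
    · rw [Function.iterate_succ_apply'] at hn
      exact ⟨T.parent^[n] u, by simp [children, hn, hv]⟩

theorem desc_of_isChain {l : List V}
    (h : (u :: l ++ [v]).IsChain fun a b => T.parent a = b) : T.Desc u v := by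
  induction l generalizing u with
  | nil => exact ⟨1, by simpa using h⟩
  | cons a l ih =>
    simp only [List.cons_append, List.isChain_cons_cons] at h
    exact Desc.trans ⟨1, h.1⟩ (ih (by simpa using h.2))

/-- Exchanging the weights of a vertex and a heavier subordinate vertex does not increase the
weight of any subordinate group. -/
theorem f_comp_swap_le {μ : V → ℝ} (huv : T.Desc u v) (hμ : μ v ≤ μ u) (w : V) :
    T.f (μ ∘ Equiv.swap v u) w ≤ T.f μ w := by
  unfold f
  by_cases hvw : T.Desc v w
  · refine (Finset.sum_equiv (Equiv.swap v u) (fun x => ?_) fun x _ => rfl).le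
    have huw := huv.trans hvw
    rcases eq_or_ne x v with rfl | hxv
    · simp [hvw, huw]
    rcases eq_or_ne x u with rfl | hxu
    · simp [hvw, huw]
    rw [Equiv.swap_apply_of_ne_of_ne hxv hxu]
  · refine Finset.sum_le_sum fun x hx => apply_swap_le hμ ?_
    rintro rfl
    exact hvw (by simpa using hx)

theorem f_comp_swap_lt {μ : V → ℝ} (huv : T.Desc u v) (hne : u ≠ v) (hμ : μ v < μ u) :
    T.f (μ ∘ Equiv.swap v u) u < T.f μ u := by
  refine Finset.sum_lt_sum (fun x hx => apply_swap_le hμ.le ?_)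
    ⟨u, by simpa using ⟨0, rfl⟩, by simpa using hμ⟩
  rintro rfl
  exact hne (huv.antisymm (by simpa using hx))

end DirTree

/-- if `T` contains a path `(v', m₁, …, m_k, v)` with `k ≥ 0`,
`d(v) = d(v')` and `μ(v') > μ(v)`, then the tree obtained by swapping all incident arcs
of `v` and `v'` (i.e. relabelling by the transposition of `v` and `v'`) lies in `ℛ(μ,d)`
and its vector of subordinate groups' weights strictly weakly majorizes that of `T`. -/
theorem exchange_lemma_five_a {V : Type} [Fintype V] [DecidableEq V]
    (μ : V → ℝ) (d : V → ℕ) (hgen : IsGenTuple μ d)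
    (T : DirTree V) (hT : memR T d)
    (v v' : V) (ms : List V)
    (hpath : ((v' :: ms) ++ [v]).Chain' fun a b => T.parent a = b)
    (hnodup : ((v' :: ms) ++ [v]).Nodup)
    (hdeg : d v = d v') (hμ : μ v < μ v')
    (T' : DirTree V) (hroot : T'.root = Equiv.swap v v' T.root)
    (hpar : ∀ u, T'.parent u = Equiv.swap v v' (T.parent (Equiv.swap v v' u))) :
    memR T' d ∧ SWMaj (T'.fvec μ) (T.fvec μ) := by
  have hdesc : T.Desc v' v := DirTree.desc_of_isChain hpath
  have hne : v' ≠ v := by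
    rintro rfl
    exact lt_irrefl _ hμ
  have hσ : ∀ u, T'.parent (Equiv.swap v v' u) = Equiv.swap v v' (T.parent u) := fun u => by
    rw [hpar, Equiv.swap_apply_self]
  have hdswap : ∀ u, d (Equiv.swap v v' u) = d u := fun u => by
    rw [Equiv.swap_apply_def]
    split_ifs with h₁ h₂
    · rw [h₁, hdeg]
    · rw [h₂, hdeg]
    · rfl
  refine ⟨⟨?_, fun u => ?_⟩, ?_⟩
  · rw [hroot, hdswap]
    exact hT.1
  · rw [← Equiv.swap_apply_self v v' u, DirTree.deg_of_semiconj hσ hroot, hT.2]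
    exact (hdswap _).symm
  · have hroot' : v' ≠ T.root := by
      rintro rfl
      exact hne hdesc.eq_root.symm
    have hdegv : 1 < T.deg v := by
      by_cases hv : v = T.root
      · rw [hT.2, hv]
        exact hT.1
      · have := (hdesc.children_nonempty hne).card_pos
        simp only [DirTree.deg, if_neg hv]
        omega
    have hdegv' : 1 < T.deg v' := by rwa [hT.2, ← hdeg, ← hT.2]
    rw [DirTree.fvec_of_semiconj hσ hroot]
    exact swMaj_map_of_le _ (DirTree.f_comp_swap_le hdesc hμ.le) (by simp [hdegv', hroot'])
      (DirTree.f_comp_swap_lt hdesc hne hμ)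
end
end
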